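/- Let S be an infinite set of monic polynomials in R = 𝔽_q[x], let m, n ∈ ℕ, and let N ∈ R with deg N = n. Then for every integer k with 1 ≤ k ≤ n/2, ν_m({α ∈ 𝔪^m : deg_{min,S}(α, q^{−n}) = k}) = (#F^m_{k,S} − #F^m_{k−1,S})/q^{mn}, and this also equals the uniform probability that a ∈ R_{<n}^m satisfies d_{N,S}(a) = k. -/

import Mathlib

open Polynomial MeasureTheory
open scoped Classical ENNReal NNReal

/- Setting: `Fq` is a finite field with `q` elements (`q` a prime power),
`R = Fq[x]`, and `K_∞ = Fq((x⁻¹))` is realized as the field `LaurentSeries Fq`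
of formal Laurent series in the variable `u = x⁻¹`. -/

variable (Fq : Type) [Field Fq] [Fintype Fq] [DecidableEq Fq]

/-- `K_∞ = 𝔽_q((x⁻¹))`, realized as Laurent series in the variable `u = x⁻¹`. -/
abbrev Kinf := LaurentSeries Fq

/-- The embedding of `R = 𝔽_q[x]` into `K_∞`, sending `x` to `u⁻¹`. -/
noncomputable def emb : Polynomial Fq →+* Kinf Fq :=
  (Polynomial.aeval ((HahnSeries.single (-1 : ℤ) (1 : Fq)) : LaurentSeries Fq)).toRingHom

/-- `q`, as a nonnegative real number. -/
noncomputable def qc : NNReal := (Fintype.card Fq : NNReal)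

/-- The absolute value `|α| = q^{-ord(α)}` on `K_∞` (so that `|f| = q^{deg f}` for a nonzero
polynomial `f ∈ 𝔽_q[x]`, since `f(u⁻¹)` has order `-deg f` as a Laurent series in `u`). -/
noncomputable def fabs (α : Kinf Fq) : NNReal :=
  if α = 0 then 0 else (qc Fq) ^ (-(HahnSeries.order α))

/-- The sup norm `‖v‖ = max_i |v_i|` on `K_∞^m`. -/
noncomputable def vnorm {m : ℕ} (v : Fin m → Kinf Fq) : NNReal :=
  Finset.univ.sup fun i => fabs Fq (v i)

/-- The maximal ideal `𝔪 = {α ∈ K_∞ : |α| ≤ q⁻¹}`. -/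
noncomputable def mfrak : Set (Kinf Fq) := {α | fabs Fq α ≤ (qc Fq)⁻¹}

/-- `𝔪^m ⊆ K_∞^m`. -/
noncomputable def mfrakV (m : ℕ) : Set (Fin m → Kinf Fq) := {α | ∀ i, α i ∈ mfrak Fq}

/-- `(P, Q)` is a primitive vector of `R^{m+1}`, i.e. `gcd(P₁, …, P_m, Q) = 1`:
every common divisor is a unit. -/
def Primitive {m : ℕ} (P : Fin m → Polynomial Fq) (Q : Polynomial Fq) : Prop :=
  ∀ d : Polynomial Fq, d ∣ Q → (∀ i, d ∣ P i) → IsUnit d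

/-- The point `P/Q ∈ K_∞^m` determined by `P ∈ R^m` and `Q ∈ R`. -/
noncomputable def ratV {m : ℕ} (P : Fin m → Polynomial Fq) (Q : Polynomial Fq) :
    Fin m → Kinf Fq := fun i => emb Fq (P i) / emb Fq Q

/-- `deg_{min,S}(α, q^{-n})`: the least `d` such that there is `(P,Q) ∈ R̂^{m+1}` with
`Q ∈ S`, `deg Q = d`, `‖P‖ < |Q|` and `‖α - P/Q‖ < q^{-n}`. -/
noncomputable def degMin (S : Set (Polynomial Fq)) (m n : ℕ) (α : Fin m → Kinf Fq) : ℕ :=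
  sInf {d : ℕ | ∃ (P : Fin m → Polynomial Fq) (Q : Polynomial Fq),
    Q ∈ S ∧ Q.natDegree = d ∧ Primitive Fq P Q ∧
    vnorm Fq (ratV Fq P 1) < fabs Fq (emb Fq Q) ∧
    vnorm Fq (α - ratV Fq P Q) < (qc Fq) ^ (-(n : ℤ))}

/-- `m_S(n) = min {k ≥ n : S ∩ R_{=k} ≠ ∅}`. -/
noncomputable def mS (S : Set (Polynomial Fq)) (n : ℕ) : ℕ :=
  sInf {k : ℕ | n ≤ k ∧ ∃ Q ∈ S, Q.natDegree = k}

/-- `d_{N,S}(a) = deg_{min,S}(a/N, q^{-deg N})`. -/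
noncomputable def dN (S : Set (Polynomial Fq)) (m : ℕ) (N : Polynomial Fq)
    (a : Fin m → Polynomial Fq) : ℕ :=
  degMin Fq S m N.natDegree (ratV Fq a N)

/-- `R_{<n}^m`, the set of vectors of polynomials of degree `< n`. -/
def polyVecLT (m n : ℕ) : Set (Fin m → Polynomial Fq) :=
  {a | ∀ i, (a i).degree < (n : ℕ)}

/-- The `S`-Farey fractions of degree at most `k` in `K_∞^m` (the zero vector is
included, as the fraction `0/1`). -/
noncomputable def Farey (S : Set (Polynomial Fq)) (m k : ℕ) : Set (Fin m → Kinf Fq) :=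
  {x | ∃ (P : Fin m → Polynomial Fq) (Q : Polynomial Fq), Q ∈ S ∧ Primitive Fq P Q ∧
    vnorm Fq (ratV Fq P 1) < fabs Fq (emb Fq Q) ∧ Q.natDegree ≤ k ∧ x = ratV Fq P Q}

/-- The (closed) ball `B(v, r) = {u ∈ K_∞^m : ‖v - u‖ ≤ r}`. -/
noncomputable def ball {m : ℕ} (v : Fin m → Kinf Fq) (r : NNReal) : Set (Fin m → Kinf Fq) :=
  {u | vnorm Fq (v - u) ≤ r}

/-- `Q` is the (unique monic) `S`-minimal denominator for `(α, q^{-n})`, i.e.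
`Q_{min,S}(α, q^{-n}) = Q`: `Q ∈ S`, `deg Q = deg_{min,S}(α, q^{-n})`, and there is
`P ∈ R^m` with `(P,Q) ∈ R̂^{m+1}` and `‖α - P/Q‖ < q^{-n}`. -/
noncomputable def IsMinDenom (S : Set (Polynomial Fq)) (m n : ℕ) (α : Fin m → Kinf Fq)
    (Q : Polynomial Fq) : Prop :=
  Q ∈ S ∧ Q.natDegree = degMin Fq S m n α ∧
    ∃ P : Fin m → Polynomial Fq, Primitive Fq P Q ∧
      vnorm Fq (α - ratV Fq P Q) < (qc Fq) ^ (-(n : ℤ))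

section Kinf

omit [DecidableEq Fq]

theorem one_lt_qc : 1 < qc Fq := by
  unfold qc; exact_mod_cast Fintype.one_lt_card

theorem qc_zpow_pos (n : ℤ) : 0 < qc Fq ^ n := zpow_pos (zero_lt_one.trans (one_lt_qc Fq)) n

variable {Fq}

theorem fabs_lt_zpow_iff (α : Kinf Fq) (n : ℤ) :
    fabs Fq α < qc Fq ^ (-n) ↔ ∀ i ≤ n, α.coeff i = 0 := by
  have hq := one_lt_qc Fq
  unfold fabs
  split_ifs with h
  · simp [h, zpow_pos (zero_lt_one.trans hq)]
  · rw [zpow_lt_zpow_iff_right₀ hq, neg_lt_neg_iff]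
    constructor
    · intro hn i hi
      exact HahnSeries.coeff_eq_zero_of_lt_order (hi.trans_lt hn)
    · intro H
      by_contra! hle
      exact h (by simpa [HahnSeries.coeff_order_eq_zero] using H _ hle)

theorem fabs_lt_one_iff (α : Kinf Fq) : fabs Fq α < 1 ↔ ∀ i ≤ 0, α.coeff i = 0 := by
  simpa using fabs_lt_zpow_iff α 0

theorem fabs_sub_lt {α β : Kinf Fq} {n : ℤ} (hα : fabs Fq α < qc Fq ^ n)
    (hβ : fabs Fq β < qc Fq ^ n) : fabs Fq (α - β) < qc Fq ^ n := by
  rw [← neg_neg n, fabs_lt_zpow_iff] at *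
  intro i hi
  simp [hα i hi, hβ i hi]

theorem fabs_neg (α : Kinf Fq) : fabs Fq (-α) = fabs Fq α := by
  simp [fabs]

theorem fabs_sub_comm (α β : Kinf Fq) : fabs Fq (α - β) = fabs Fq (β - α) := by
  rw [← fabs_neg, neg_sub]

theorem fabs_mul (α β : Kinf Fq) : fabs Fq (α * β) = fabs Fq α * fabs Fq β := by
  by_cases hα : α = 0
  · simp [fabs, hα]
  by_cases hβ : β = 0
  · simp [fabs, hβ]
  have hq : qc Fq ≠ 0 := (zero_lt_one.trans (one_lt_qc Fq)).ne'
  simp only [fabs, hα, hβ, mul_eq_zero, or_self, if_false]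
  rw [HahnSeries.order_mul hα hβ, neg_add, zpow_add₀ hq]

omit [Fintype Fq] in
theorem emb_monomial (k : ℕ) (a : Fq) :
    emb Fq (monomial k a) = HahnSeries.single (-(k : ℤ)) a := by
  simp [emb, aeval_monomial, HahnSeries.single_pow, LaurentSeries.algebraMap_apply]

omit [Fintype Fq] in
theorem coeff_emb (p : Fq[X]) (i : ℤ) :
    (emb Fq p).coeff i = if i ≤ 0 then p.coeff (-i).toNat else 0 := by
  induction p using Polynomial.induction_on' with
  | add p r hp hr =>
    rw [map_add, HahnSeries.coeff_add, hp, hr]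
    split_ifs <;> simp
  | monomial k a =>
    rw [emb_monomial, HahnSeries.coeff_single, coeff_monomial]
    split_ifs <;> first | rfl | omega

theorem fabs_emb_lt_iff (p : Fq[X]) (d : ℕ) :
    fabs Fq (emb Fq p) < qc Fq ^ (d : ℤ) ↔ p.degree < d := by
  rw [← neg_neg (d : ℤ), fabs_lt_zpow_iff, degree_lt_iff_coeff_zero]
  constructor
  · intro h k hk
    simpa [coeff_emb] using h (-(k : ℤ)) (by omega)
  · intro h i hi
    rw [coeff_emb, if_pos (by omega)]
    exact h _ (by omega)

theorem fabs_emb_lt_one_iff (p : Fq[X]) : fabs Fq (emb Fq p) < 1 ↔ p = 0 := by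
  simpa [Nat.WithBot.lt_zero_iff] using fabs_emb_lt_iff p 0

theorem emb_ne_zero {p : Fq[X]} (hp : p ≠ 0) : emb Fq p ≠ 0 := by
  intro h
  exact hp ((fabs_emb_lt_one_iff p).1 (by simp [h, fabs]))

theorem fabs_emb {p : Fq[X]} (hp : p ≠ 0) : fabs Fq (emb Fq p) = qc Fq ^ (p.natDegree : ℤ) := by
  have h1 : (emb Fq p).order = -(p.natDegree : ℤ) := by
    apply le_antisymm
    · apply HahnSeries.order_le_of_coeff_ne_zero
      simpa [coeff_emb] using hp
    · by_contra! h
      have := HahnSeries.coeff_order_eq_zero.not.2 (emb_ne_zero hp)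
      rw [coeff_emb, if_pos (by omega)] at this
      exact this (coeff_eq_zero_of_natDegree_lt (by omega))
  rw [fabs, if_neg (emb_ne_zero hp), h1, neg_neg]

theorem exists_fabs_sub_emb_lt_one (α : Kinf Fq) : ∃ p : Fq[X], fabs Fq (α - emb Fq p) < 1 := by
  refine ⟨∑ k ∈ Finset.range ((-α.order).toNat + 1), monomial k (α.coeff (-(k : ℤ))), ?_⟩
  rw [fabs_lt_one_iff]
  intro i hi
  rw [HahnSeries.coeff_sub, coeff_emb, if_pos hi, finsetSum_coeff]
  simp only [coeff_monomial, Finset.sum_ite_eq', Finset.mem_range]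
  split_ifs with h
  · rw [show -((-i).toNat : ℤ) = i by omega, sub_self]
  · rw [sub_zero]
    exact HahnSeries.coeff_eq_zero_of_lt_order (by omega)

theorem fabs_sub_div_emb_lt_iff {N : Fq[X]} (hN : N ≠ 0) (α β : Kinf Fq) :
    fabs Fq (α - β / emb Fq N) < qc Fq ^ (-(N.natDegree : ℤ)) ↔
      fabs Fq (α * emb Fq N - β) < 1 := by
  have h : α * emb Fq N - β = (α - β / emb Fq N) * emb Fq N := by
    field_simp [emb_ne_zero hN]
  rw [h, fabs_mul, fabs_emb hN, zpow_neg, ← one_div, lt_div_iff₀ (qc_zpow_pos Fq _)]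

theorem exists_degree_lt_fabs_sub_lt {N : Fq[X]} (hN : N ≠ 0) {α : Kinf Fq}
    (hα : fabs Fq α < 1) :
    ∃ a : Fq[X], a.degree < N.natDegree ∧
      fabs Fq (α - emb Fq a / emb Fq N) < qc Fq ^ (-(N.natDegree : ℤ)) := by
  obtain ⟨a, ha⟩ := exists_fabs_sub_emb_lt_one (α * emb Fq N)
  refine ⟨a, ?_, (fabs_sub_div_emb_lt_iff hN α _).2 ha⟩
  rw [← fabs_emb_lt_iff]
  have h1 : fabs Fq (α * emb Fq N) < qc Fq ^ (N.natDegree : ℤ) := by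
    rw [fabs_mul, fabs_emb hN]
    exact mul_lt_of_lt_one_left (qc_zpow_pos Fq _) hα
  have h2 := ha.trans_le (one_le_zpow₀ (one_lt_qc Fq).le (Int.natCast_nonneg N.natDegree))
  simpa using fabs_sub_lt h1 h2

theorem eq_of_fabs_sub_div_lt {N : Fq[X]} (hN : N ≠ 0) {α : Kinf Fq} {a b : Fq[X]}
    (ha : fabs Fq (α - emb Fq a / emb Fq N) < qc Fq ^ (-(N.natDegree : ℤ)))
    (hb : fabs Fq (α - emb Fq b / emb Fq N) < qc Fq ^ (-(N.natDegree : ℤ))) : a = b := by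
  rw [fabs_sub_div_emb_lt_iff hN] at ha hb
  have := fabs_sub_lt (n := 0) (by simpa using hb) (by simpa using ha)
  rw [zpow_zero, sub_sub_sub_cancel_left, ← map_sub, fabs_emb_lt_one_iff] at this
  exact sub_eq_zero.1 this

theorem fabs_div_emb_lt_one {N a : Fq[X]} (ha : a.degree < N.natDegree) :
    fabs Fq (emb Fq a / emb Fq N) < 1 := by
  by_cases hN : N = 0
  · simp [hN, fabs]
  have h : fabs Fq (emb Fq a / emb Fq N) * qc Fq ^ (N.natDegree : ℤ) = fabs Fq (emb Fq a) := by
    rw [← fabs_emb hN, ← fabs_mul, div_mul_cancel₀ _ (emb_ne_zero hN)]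
  rw [← fabs_emb_lt_iff, ← h] at ha
  exact (mul_lt_iff_lt_one_left (qc_zpow_pos Fq _)).1 ha

theorem fabs_lt_one_of_fabs_sub_lt {α β : Kinf Fq} {n : ℕ} (hβ : fabs Fq β < 1)
    (h : fabs Fq (α - β) < qc Fq ^ (-(n : ℤ))) : fabs Fq α < 1 := by
  rw [fabs_lt_one_iff] at *
  rw [fabs_lt_zpow_iff] at h
  intro i hi
  have := h i (by omega)
  rwa [HahnSeries.coeff_sub, hβ i hi, sub_zero] at this

theorem mem_mfrak_iff (α : Kinf Fq) : α ∈ mfrak Fq ↔ fabs Fq α < 1 := by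
  have hq := one_lt_qc Fq
  unfold mfrak fabs
  rw [Set.mem_ofPred_eq]
  split_ifs with h
  · simp
  · rw [← zpow_neg_one, ← zpow_zero (qc Fq), zpow_le_zpow_iff_right₀ hq,
      zpow_lt_zpow_iff_right₀ hq]
    omega

theorem finite_degree_lt (n : ℕ) : {p : Fq[X] | p.degree < n}.Finite := by
  have h : Finite (degreeLT Fq n) := Finite.of_equiv _ (degreeLTEquiv Fq n).symm.toEquiv
  convert Set.toFinite (degreeLT Fq n : Set Fq[X])
  ext p; simp [mem_degreeLT]

theorem ncard_degree_lt (n : ℕ) :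
    {p : Fq[X] | p.degree < n}.ncard = Fintype.card Fq ^ n := by
  have : {p : Fq[X] | p.degree < n} = (degreeLT Fq n : Set Fq[X]) := by
    ext p; simp [mem_degreeLT]
  rw [this, ← Nat.card_coe_set_eq]
  exact (Nat.card_congr (degreeLTEquiv Fq n).toEquiv).trans (by simp)

theorem finite_polyVecLT (m n : ℕ) : (polyVecLT Fq m n).Finite :=
  Set.Finite.pi' fun _ => finite_degree_lt n

/-- The open ball of radius `q^{-n}` around `x` in `K_∞`. -/
def openBall (n : ℕ) (x : Kinf Fq) : Set (Kinf Fq) :=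
  {α | fabs Fq (α - x) < qc Fq ^ (-(n : ℤ))}

theorem isOpen_openBall (n : ℕ) (x : Kinf Fq) : IsOpen (openBall n x) := by
  have h0 : IsOpen {α : Kinf Fq | Valued.v α ≤ WithZero.exp (-((n : ℤ) + 1))} := by
    obtain ⟨y, hy⟩ := LaurentSeries.valuation_surjective (K := Fq) (WithZero.exp (-((n : ℤ) + 1)))
    have := Valued.isOpen_closedBall (R := Kinf Fq) 
      (Γ₀ := WithZero (Multiplicative ℤ)) (r := Valued.v.restrict y) (by
        rw [Ne, Valuation.restrict_eq_zero_iff, hy]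
        exact WithZero.exp_ne_zero)
    simpa only [Valuation.restrict_le_iff, hy] using this
  have h : openBall n x =
      (fun α => α - x) ⁻¹' {α : Kinf Fq | Valued.v α ≤ WithZero.exp (-((n : ℤ) + 1))} := by
    ext α
    simp only [openBall, Set.mem_ofPred_eq, Set.mem_preimage]
    rw [fabs_lt_zpow_iff, LaurentSeries.valuation_le_iff_coeff_lt_eq_zero]
    simp only [Int.lt_add_one_iff]
  rw [h]
  exact h0.preimage (continuous_sub_right x)

section Measure

variable [MeasurableSpace (Kinf Fq)] [BorelSpace (Kinf Fq)] {ν : Measure (Kinf Fq)}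
  [ν.IsAddLeftInvariant]

theorem measure_openBall_eq (n : ℕ) (x : Kinf Fq) : ν (openBall n x) = ν (openBall n 0) := by
  rw [← measure_preimage_add ν (-x) (openBall n 0)]
  congr 1
  ext α
  simp [openBall, sub_eq_neg_add]

theorem measure_openBall (hν : ν (mfrak Fq) = 1) (n : ℕ) (x : Kinf Fq) :
    ν (openBall n x) = ((Fintype.card Fq : ℝ≥0∞) ^ n)⁻¹ := by
  set N : Fq[X] := X ^ n with hNdef
  have hN : N ≠ 0 := pow_ne_zero _ X_ne_zero
  have hn : N.natDegree = n := natDegree_X_pow n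
  have hunion : mfrak Fq =
      ⋃ a ∈ (finite_degree_lt (Fq := Fq) n).toFinset, openBall n (emb Fq a / emb Fq N) := by
    ext α
    simp only [mem_mfrak_iff, Set.mem_iUnion, Set.Finite.mem_toFinset, Set.mem_ofPred_eq,
      exists_prop, openBall]
    constructor
    · intro h
      simpa [hn] using exists_degree_lt_fabs_sub_lt hN h
    · rintro ⟨a, ha, h⟩
      exact fabs_lt_one_of_fabs_sub_lt (fabs_div_emb_lt_one (by rwa [hn])) h
  rw [hunion, measure_biUnion_finset] at hν
  · simp_rw [measure_openBall_eq (ν := ν) n (_ / _)] at hν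
    rw [Finset.sum_const, nsmul_eq_mul, ← Set.ncard_eq_toFinset_card _ _, ncard_degree_lt] at hν
    rw [measure_openBall_eq]
    push_cast at hν
    exact ENNReal.eq_inv_of_mul_eq_one_left (by rwa [mul_comm])
  · intro a _ b _ hab
    refine Set.disjoint_left.2 fun α ha hb => hab ?_
    exact eq_of_fabs_sub_div_lt hN (by rwa [hn]) (by rwa [hn])
  · exact fun a _ => (isOpen_openBall n _).measurableSet

end Measure

theorem vnorm_lt_iff {m : ℕ} (v : Fin m → Kinf Fq) {r : NNReal} (hr : 0 < r) :
    vnorm Fq v < r ↔ ∀ i, fabs Fq (v i) < r := by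
  simp [vnorm, Finset.sup_lt_iff (show (⊥ : NNReal) < r from hr)]

theorem Farey_mono (S : Set Fq[X]) (m : ℕ) {j k : ℕ} (h : j ≤ k) :
    Farey Fq S m j ⊆ Farey Fq S m k := by
  rintro x ⟨P, Q, h1, h2, h3, h4, h5⟩
  exact ⟨P, Q, h1, h2, h3, h4.trans h, h5⟩

section Monic

variable {S : Set Fq[X]} (hS : ∀ Q ∈ S, Q.Monic) {m n k : ℕ}
include hS

theorem fabs_lt_one_of_mem_Farey {x : Fin m → Kinf Fq} (hx : x ∈ Farey Fq S m k) (i : Fin m) :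
    fabs Fq (x i) < 1 := by
  obtain ⟨P, Q, hQ, -, hP, -, rfl⟩ := hx
  have hQ0 := (hS Q hQ).ne_zero
  rw [fabs_emb hQ0, vnorm_lt_iff _ (qc_zpow_pos Fq _)] at hP
  have := hP i
  simp only [ratV, map_one, div_one] at this
  exact fabs_div_emb_lt_one ((fabs_emb_lt_iff _ _).1 this)

theorem Farey_eq_of_close (hk : 2 * k ≤ n) {x y α : Fin m → Kinf Fq}
    (hx : x ∈ Farey Fq S m k) (hy : y ∈ Farey Fq S m k)
    (hxα : ∀ i, α i ∈ openBall n (x i)) (hyα : ∀ i, α i ∈ openBall n (y i)) : x = y := by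
  obtain ⟨P, Q, hQ, -, -, hQk, rfl⟩ := hx
  obtain ⟨P', Q', hQ', -, -, hQk', rfl⟩ := hy
  have h0 := (hS Q hQ).ne_zero
  have h0' := (hS Q' hQ').ne_zero
  funext i
  have e0 := emb_ne_zero h0
  have e0' := emb_ne_zero h0'
  have hlt := fabs_sub_lt (hyα i) (hxα i)
  rw [sub_sub_sub_cancel_left] at hlt
  have heq : emb Fq (P i * Q' - P' i * Q) = (ratV Fq P Q i - ratV Fq P' Q' i) * emb Fq (Q * Q') := by
    simp only [ratV, map_sub, map_mul]
    field_simp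
  have hnum : fabs Fq (emb Fq (P i * Q' - P' i * Q)) < 1 := by
    rw [heq, fabs_mul, fabs_emb (mul_ne_zero h0 h0'), natDegree_mul h0 h0']
    calc _ < qc Fq ^ (-(n : ℤ)) * qc Fq ^ ((Q.natDegree + Q'.natDegree : ℕ) : ℤ) :=
          mul_lt_mul_of_pos_right hlt (qc_zpow_pos Fq _)
      _ = qc Fq ^ (-(n : ℤ) + (Q.natDegree + Q'.natDegree : ℕ)) :=
          (zpow_add₀ (zero_lt_one.trans (one_lt_qc Fq)).ne' _ _).symm
      _ ≤ 1 := zpow_le_one_of_nonpos₀ (one_lt_qc Fq).le (by omega)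
  rw [(fabs_emb_lt_one_iff _).1 hnum, map_zero, eq_comm, mul_eq_zero] at heq
  exact sub_eq_zero.1 (heq.resolve_right (emb_ne_zero (mul_ne_zero h0 h0')))

theorem degMin_eq_iff (hk : 2 * k ≤ n) (hk₁ : 1 ≤ k) (α : Fin m → Kinf Fq) :
    degMin Fq S m n α = k ↔
      ∃ x ∈ Farey Fq S m k \ Farey Fq S m (k - 1), ∀ i, α i ∈ openBall n (x i) := by
  unfold degMin
  set D := {d : ℕ | ∃ (P : Fin m → Polynomial Fq) (Q : Polynomial Fq),
    Q ∈ S ∧ Q.natDegree = d ∧ Primitive Fq P Q ∧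
    vnorm Fq (ratV Fq P 1) < fabs Fq (emb Fq Q) ∧
    vnorm Fq (α - ratV Fq P Q) < (qc Fq) ^ (-(n : ℤ))} with hD
  have key : ∀ j, (∃ d ≤ j, d ∈ D) ↔ ∃ x ∈ Farey Fq S m j, ∀ i, α i ∈ openBall n (x i) := by
    intro j
    constructor
    · rintro ⟨d, hd, P, Q, h1, h2, h3, h4, h5⟩
      exact ⟨_, ⟨P, Q, h1, h3, h4, h2.trans_le hd, rfl⟩,
        (vnorm_lt_iff _ (qc_zpow_pos Fq _)).1 h5⟩
    · rintro ⟨x, ⟨P, Q, h1, h3, h4, h5, rfl⟩, h⟩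
      exact ⟨_, h5, P, Q, h1, rfl, h3, h4, (vnorm_lt_iff _ (qc_zpow_pos Fq _)).2 h⟩
  constructor
  · intro h
    have hne : D.Nonempty := Nat.nonempty_of_pos_sInf (by omega)
    obtain ⟨x, hx, hxα⟩ := (key k).1 ⟨_, h.le, Nat.sInf_mem hne⟩
    refine ⟨x, ⟨hx, fun hx' => ?_⟩, hxα⟩
    obtain ⟨d, hd, hdD⟩ := (key (k - 1)).2 ⟨x, hx', hxα⟩
    have := Nat.sInf_le hdD
    omega
  · rintro ⟨x, ⟨hx, hx'⟩, hxα⟩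
    obtain ⟨d, hd, hdD⟩ := (key k).2 ⟨x, hx, hxα⟩
    apply le_antisymm ((Nat.sInf_le hdD).trans hd)
    by_contra! hlt
    obtain ⟨y, hy, hyα⟩ := (key (k - 1)).1 ⟨_, by omega, Nat.sInf_mem ⟨d, hdD⟩⟩
    have := Farey_eq_of_close hS hk hx (Farey_mono S m (Nat.sub_le k 1) hy) hxα hyα
    exact hx' (this ▸ hy)

theorem exists_polyVecLT_openBall {N : Fq[X]} (hN : N ≠ 0) (x : Fin m → Kinf Fq)
    (hx : x ∈ Farey Fq S m k) :
    ∃ a ∈ polyVecLT Fq m N.natDegree, ∀ i, ratV Fq a N i ∈ openBall N.natDegree (x i) := by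
  choose a ha h using fun i => exists_degree_lt_fabs_sub_lt hN (fabs_lt_one_of_mem_Farey hS hx i)
  exact ⟨a, ha, fun i => by simpa only [openBall, ratV, Set.mem_ofPred_eq, fabs_sub_comm] using h i⟩

theorem finite_Farey (m k : ℕ) : (Farey Fq S m k).Finite := by
  have hN : (X ^ (2 * k) : Fq[X]) ≠ 0 := pow_ne_zero _ X_ne_zero
  choose! f hf hfx using exists_polyVecLT_openBall hS (m := m) (k := k) hN
  refine Set.Finite.of_injOn hf ?_ (finite_polyVecLT m _)
  intro x hx y hy hxy
  exact Farey_eq_of_close hS (by simp) hx hy (hfx x hx) (hxy ▸ hfx y hy)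

theorem ncard_dN_eq {N : Fq[X]} (hN : N ≠ 0) (hk : 2 * k ≤ N.natDegree) (hk₁ : 1 ≤ k) :
    {a ∈ polyVecLT Fq m N.natDegree | dN Fq S m N a = k}.ncard =
      (Farey Fq S m k \ Farey Fq S m (k - 1)).ncard := by
  choose! f hf hfx using exists_polyVecLT_openBall hS (m := m) (k := k) hN
  have himage : {a ∈ polyVecLT Fq m N.natDegree | dN Fq S m N a = k} =
      f '' (Farey Fq S m k \ Farey Fq S m (k - 1)) := by
    ext a
    simp only [Set.mem_ofPred_eq, dN, degMin_eq_iff hS hk hk₁, Set.mem_image]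
    constructor
    · rintro ⟨ha, x, hx, hxa⟩
      refine ⟨x, hx, funext fun i => ?_⟩
      have h1 := hfx x hx.1 i
      have h2 := hxa i
      simp only [openBall, Set.mem_ofPred_eq, fabs_sub_comm _ (x i)] at h1 h2
      exact eq_of_fabs_sub_div_lt hN h1 h2
    · rintro ⟨x, hx, rfl⟩
      exact ⟨hf x hx.1, x, hx, hfx x hx.1⟩
  rw [himage, Set.InjOn.ncard_image]
  intro x hx y hy hxy
  exact Farey_eq_of_close hS hk hx.1 hy.1 (hfx x hx.1) (hxy ▸ hfx y hy.1)

theorem measure_degMin_eq [MeasurableSpace (Kinf Fq)] [BorelSpace (Kinf Fq)]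
    {ν : Measure (Kinf Fq)} [SigmaFinite ν] [ν.IsAddLeftInvariant] (hν : ν (mfrak Fq) = 1)
    (hk : 2 * k ≤ n) (hk₁ : 1 ≤ k) :
    Measure.pi (fun _ : Fin m => ν) {α ∈ mfrakV Fq m | degMin Fq S m n α = k} =
      ((Farey Fq S m k \ Farey Fq S m (k - 1)).ncard : ℝ≥0∞) /
        (Fintype.card Fq : ℝ≥0∞) ^ (m * n) := by
  have hfin := (finite_Farey hS m k).sdiff (t := Farey Fq S m (k - 1))
  have hunion : {α ∈ mfrakV Fq m | degMin Fq S m n α = k} =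
      ⋃ x ∈ hfin.toFinset, Set.univ.pi fun i => openBall n (x i) := by
    ext α
    simp only [Set.mem_ofPred_eq, degMin_eq_iff hS hk hk₁, Set.mem_iUnion,
      Set.Finite.mem_toFinset, Set.mem_univ_pi, exists_prop, and_iff_right_iff_imp]
    rintro ⟨x, hx, hxα⟩ i
    exact (mem_mfrak_iff _).2
      (fabs_lt_one_of_fabs_sub_lt (fabs_lt_one_of_mem_Farey hS hx.1 i) (hxα i))
  rw [hunion, measure_biUnion_finset]
  · simp_rw [Measure.pi_pi, measure_openBall hν]
    rw [Finset.sum_const, nsmul_eq_mul, ← Set.ncard_eq_toFinset_card _ _, Finset.prod_const,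
      Finset.card_univ, Fintype.card_fin, ← ENNReal.inv_pow, ← pow_mul, mul_comm n m,
      div_eq_mul_inv]
  · intro x hx y hy hxy
    simp only [Set.Finite.coe_toFinset] at hx hy
    refine Set.disjoint_left.2 fun α ha hb => hxy ?_
    exact Farey_eq_of_close hS hk hx.1 hy.1 (Set.mem_univ_pi.1 ha) (Set.mem_univ_pi.1 hb)
  · exact fun x _ => MeasurableSet.univ_pi fun i => (isOpen_openBall n _).measurableSet

end Monic

end Kinf

/-- Corollary 2.1: for every `1 ≤ k ≤ n/2`,
`ν_m({α ∈ 𝔪^m : deg_{min,S}(α,q^{-n}) = k}) = (#F^m_{k,S} - #F^m_{k-1,S})/q^{mn}`, and this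
also equals the uniform probability that `a ∈ R_{<n}^m` has `d_{N,S}(a) = k`. -/
theorem stmt7 (S : Set (Polynomial Fq)) (hSinf : S.Infinite) (hSmonic : ∀ Q ∈ S, Q.Monic)
    [MeasurableSpace (Kinf Fq)] [BorelSpace (Kinf Fq)]
    (ν : Measure (Kinf Fq)) [SigmaFinite ν] [ν.IsAddLeftInvariant]
    (hν : ν (mfrak Fq) = 1)
    (m n : ℕ) (N : Polynomial Fq) (hN : N.degree = (n : WithBot ℕ))
    (k : ℕ) (hk₁ : 1 ≤ k) (hk₂ : 2 * k ≤ n) :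
    (Measure.pi (fun _ : Fin m => ν) {α ∈ mfrakV Fq m | degMin Fq S m n α = k}
        = (((Farey Fq S m k).ncard - (Farey Fq S m (k - 1)).ncard : ℕ) : ℝ≥0∞)
            / (Fintype.card Fq : ℝ≥0∞) ^ (m * n)) ∧
    ((Set.ncard {a ∈ polyVecLT Fq m n | dN Fq S m N a = k} : ℝ≥0∞)
          / (Fintype.card Fq : ℝ≥0∞) ^ (m * n)
        = (((Farey Fq S m k).ncard - (Farey Fq S m (k - 1)).ncard : ℕ) : ℝ≥0∞)
            / (Fintype.card Fq : ℝ≥0∞) ^ (m * n)) := by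
  have hN0 : N ≠ 0 := by rintro rfl; simp at hN
  obtain rfl : N.natDegree = n := natDegree_eq_of_degree_eq_some hN
  rw [← Set.ncard_sdiff (Farey_mono S m (Nat.sub_le k 1)) (finite_Farey hSmonic m (k - 1)),
    ncard_dN_eq hSmonic hN0 hk₂ hk₁]
  exact ⟨measure_degMin_eq hSmonic hν hk₂ hk₁, rfl⟩
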